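/- arXiv:2502.10052 — 2 statements merged into one kernel-verified Lean document; each statement's English description precedes it below -/
import Mathlib

section
/- Let D = (V+r, E) be an acyclic rooted digraph. Then F ⊆ E is a maximal flame of D if and only if F ∩ in_D(v) is a base of the gammoid G_D(v) for every v ∈ V, i.e. if and only if F is a base of the direct sum matroid M = ⋃_{v ∈ V} G_D(v). -/
/- Common setup: a rooted digraph `D = (V+r, E)` is modelled as a finite
vertex type `α` (whose elements are `V ∪ {r}`), a finite edge type `E`
(allowing parallel edges, i.e. a multigraph) and maps `tail head : E → α`.
Subgraphs / edge subsets are sets `F : Set E`; the whole digraph `D`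
corresponds to the edge set `Set.univ`.  "`v ∈ V`" is rendered as `v ≠ r`,
and a vertex subset `X ⊆ V` as `X : Set α` with `r ∉ X`. -/

/-- In-degree of the vertex `v` in the digraph with edge set `F`. -/
noncomputable def inDeg {α E : Type*} (head : E → α) (F : Set E) (v : α) : ℕ :=
  {e ∈ F | head e = v}.ncard

/-- `ϱ_F(X)`: the number of edges of `F` entering the vertex set `X`
(tail outside `X`, head in `X`). -/
noncomputable def rho {α E : Type*} (tail head : E → α) (F : Set E) (X : Set α) : ℕ :=
  {e ∈ F | tail e ∉ X ∧ head e ∈ X}.ncard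

/-- `p` is a directed path from `r` to `v` using edges of `F`:
a nonempty list of consecutive edges, starting at `r`, ending at `v`, and
visiting pairwise distinct vertices. -/
def IsRVPath {α E : Type*} (tail head : E → α) (F : Set E) (r v : α) (p : List E) : Prop :=
  (∀ e ∈ p, e ∈ F) ∧
  List.Chain' (fun e f => head e = tail f) p ∧
  (p.map tail).Nodup ∧ (∀ e ∈ p, tail e ≠ v) ∧
  (∃ e, p.head? = some e ∧ tail e = r) ∧
  (∃ e, p.getLast? = some e ∧ head e = v)

/-- There exist `n` pairwise edge-disjoint directed paths from `r` to `v`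
in the edge set `F`. -/
def HasEDPaths {α E : Type*} (tail head : E → α) (F : Set E) (r v : α) (n : ℕ) : Prop :=
  ∃ P : Fin n → List E, (∀ i, IsRVPath tail head F r v (P i)) ∧
    ∀ i j, i ≠ j → ∀ e, e ∈ P i → e ∉ P j

/-- `λ_F(r,v)`: the local edge-connectivity from `r` to `v`, i.e. the maximum
number of pairwise edge-disjoint directed paths from `r` to `v` in `F`. -/
noncomputable def lam {α E : Type*} (tail head : E → α) (F : Set E) (r v : α) : ℕ :=
  sSup {n | HasEDPaths tail head F r v n}

/-- `X` is a `v`-tight vertex set in the digraph with edge set `F` and root `r`: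
`X ⊆ V` (i.e. `r ∉ X`), `v ∈ X` and `ϱ_F(X) = λ_F(r,v)`. -/
def Tight {α E : Type*} (tail head : E → α) (F : Set E) (r v : α) (X : Set α) : Prop :=
  v ∈ X ∧ r ∉ X ∧ rho tail head F X = lam tail head F r v

/-- The digraph with edge set `F` is a flame with root `r`:
`λ_F(r,v) = ϱ_F(v)` for every `v ∈ V`. -/
def IsFlame {α E : Type*} (tail head : E → α) (F : Set E) (r : α) : Prop :=
  ∀ v, v ≠ r → lam tail head F r v = inDeg head F v

/-- `F` is a maximal flame within the ambient edge set `A`: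
`λ_A(r,v) = λ_F(r,v) = ϱ_F(v)` for every `v ∈ V`. -/
def IsMaxFlameIn {α E : Type*} (tail head : E → α) (A : Set E) (r : α) (F : Set E) : Prop :=
  F ⊆ A ∧ ∀ v, v ≠ r →
    lam tail head A r v = lam tail head F r v ∧
    lam tail head F r v = inDeg head F v

/-- A closed directed walk in `F` with pairwise distinct edges.  (If every
vertex is entered by at most one edge of `F`, the existence of such a walk is
equivalent to the existence of an undirected cycle in `F`.) -/
def IsDicycle {α E : Type*} (tail head : E → α) (F : Set E) (p : List E) : Prop :=
  p.Nodup ∧ (∀ e ∈ p, e ∈ F) ∧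
  List.Chain' (fun e f => head e = tail f) p ∧
  (∃ e f, p.head? = some e ∧ p.getLast? = some f ∧ head f = tail e)

/-- `B` is a branching: every vertex is entered by at most one edge of `B` and,
disregarding edge directions, `B` contains no cycle (under the in-degree
condition this is equivalent to containing no directed cycle). -/
def IsBranching {α E : Type*} (tail head : E → α) (B : Set E) : Prop :=
  (∀ v, inDeg head B v ≤ 1) ∧ ∀ p : List E, ¬ IsDicycle tail head B p

/-- The head-set of an edge set `B`: the vertices entered by an edge of `B`. -/
def headSet {α E : Type*} (head : E → α) (B : Set E) : Set α := {v | ∃ e ∈ B, head e = v}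

/-- Independence in the gammoid `G_D(v)` (with `D` the whole digraph, edge set
`Set.univ`): `X ⊆ in_D(v)` is independent if there are `|X|` pairwise
edge-disjoint directed paths from `r` to `v` in `D` whose set of last edges is
exactly `X`. -/
def GammoidIndep {α E : Type*} (tail head : E → α) (r v : α) (X : Set E) : Prop :=
  ∃ P : Fin X.ncard → List E,
    (∀ i, IsRVPath tail head Set.univ r v (P i)) ∧
    (∀ i j, i ≠ j → ∀ e, e ∈ P i → e ∉ P j) ∧
    (∀ e, e ∈ X ↔ ∃ i, (P i).getLast? = some e)

section Rank

variable {α E : Type*} {tail head : E → α}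

/-- A closed directed walk with distinct edges can be cut out of any directed walk that repeats
an edge. -/
theorem exists_isDicycle_of_not_nodup {p : List E}
    (hc : List.IsChain (fun e f => head e = tail f) p) (hp : ¬ p.Nodup) :
    ∃ q, IsDicycle tail head Set.univ q := by
  induction p with
  | nil => simp at hp
  | cons a q ih =>
    by_cases hq : q.Nodup
    · have ha : a ∈ q := by simpa [hq] using hp
      obtain ⟨s, t, rfl⟩ := List.append_of_mem ha
      have hc' : List.IsChain (fun e f => head e = tail f) ((a :: s) ++ (a :: t)) := by
        simpa using hc
      obtain ⟨h1, -, h3⟩ := List.isChain_append.1 hc'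
      have has : a ∉ s := fun h => (List.nodup_append.1 hq).2.2 a h a (by simp) rfl
      refine ⟨a :: s, List.nodup_cons.2 ⟨has, (List.nodup_append.1 hq).1⟩, by simp, h1,
        a, (a :: s).getLast (by simp), by simp, List.getLast?_eq_some_getLast _, ?_⟩
      exact h3 _ (List.getLast?_eq_some_getLast _) a (by simp)
    · exact ih hc.tail hq

/-- In an acyclic digraph no vertex reaches itself by a nonempty walk. -/
theorem not_transGen_self (hacyc : ∀ p : List E, ¬ IsDicycle tail head Set.univ p) (u : α) :
    ¬ Relation.TransGen (fun x y => ∃ e, tail e = x ∧ head e = y) u u := by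
  have walk : ∀ x y, Relation.TransGen (fun x y => ∃ e, tail e = x ∧ head e = y) x y →
      ∃ p : List E, List.IsChain (fun e f => head e = tail f) p ∧
        (∃ e, p.head? = some e ∧ tail e = x) ∧ (∃ e, p.getLast? = some e ∧ head e = y) := by
    intro x y h
    induction h using Relation.TransGen.head_induction_on with
    | single h =>
      obtain ⟨e, he, he'⟩ := h
      exact ⟨[e], by simp, ⟨e, by simp, he⟩, ⟨e, by simp, he'⟩⟩
    | head h _ ih =>
      obtain ⟨e, he, he'⟩ := h
      obtain ⟨p, hp, ⟨a, ha, hat⟩, ⟨b, hb, hbh⟩⟩ := ih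
      obtain ⟨q, rfl⟩ := List.head?_eq_some_iff.1 ha
      exact ⟨e :: a :: q, List.isChain_cons_cons.2 ⟨he'.trans hat.symm, hp⟩, ⟨e, rfl, he⟩,
        ⟨b, by simpa using hb, hbh⟩⟩
  intro h
  obtain ⟨p, hp, ⟨a, ha, hat⟩, ⟨b, hb, hbh⟩⟩ := walk u u h
  by_cases hn : p.Nodup
  · exact hacyc p ⟨hn, by simp, hp, a, b, ha, hb, hbh.trans hat.symm⟩
  · obtain ⟨q, hq⟩ := exists_isDicycle_of_not_nodup hp hn
    exact hacyc q hq

/-- An acyclic digraph has a rank function strictly increasing along its edges. -/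
theorem exists_rank [Finite α] (hacyc : ∀ p : List E, ¬ IsDicycle tail head Set.univ p) :
    ∃ f : α → ℕ, ∀ e, f (tail e) < f (head e) := by
  refine ⟨fun v => {u | Relation.TransGen (fun x y => ∃ e, tail e = x ∧ head e = y) u v}.ncard,
    fun e => Set.ncard_lt_ncard ⟨fun u hu => hu.tail ⟨e, rfl, rfl⟩, fun hsub => ?_⟩⟩
  exact not_transGen_self hacyc (tail e) (hsub (Relation.TransGen.single ⟨e, rfl, rfl⟩))

theorem eq_or_rank_head_lt_of_isChain {f : α → ℕ} (hf : ∀ e, f (tail e) < f (head e))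
    {p : List E} (hc : List.IsChain (fun e f => head e = tail f) p) {l : E}
    (hl : p.getLast? = some l) {e : E} (he : e ∈ p) : e = l ∨ f (head e) < f (head l) := by
  induction p generalizing e with
  | nil => simp at he
  | cons a q ih =>
    cases q with
    | nil => simp_all
    | cons b t =>
      obtain ⟨hab, hc'⟩ := List.isChain_cons_cons.1 hc
      have hl' : (b :: t).getLast? = some l := by simpa using hl
      rcases List.mem_cons.1 he with rfl | he
      · right
        have hb := hf b
        rcases ih hc' hl' (List.mem_cons_self (a := b) (l := t)) with rfl | h
        · rwa [hab]
        · rw [hab]; omega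
      · exact ih hc' hl' he

/-- In a ranked digraph every directed walk is a directed path. -/
theorem isRVPath_of_isChain {f : α → ℕ} (hf : ∀ e, f (tail e) < f (head e)) {A : Set E}
    {r v : α} {p : List E} (hA : ∀ e ∈ p, e ∈ A)
    (hc : List.IsChain (fun e f => head e = tail f) p)
    (hr : ∃ e, p.head? = some e ∧ tail e = r) (hv : ∃ e, p.getLast? = some e ∧ head e = v) :
    IsRVPath tail head A r v p := by
  refine ⟨hA, hc, ?_, fun e he htv => ?_, hr, hv⟩
  · have h1 : List.IsChain (fun a b => f a < f b) (p.map tail) := by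
      rw [List.isChain_map]
      exact hc.imp fun {a b} (hab : head a = tail b) => hab ▸ hf a
    have h2 : (p.map tail).Pairwise (fun a b => f a < f b) := by
      have : IsTrans α (fun a b => f a < f b) := ⟨fun _ _ _ => lt_trans⟩
      exact h1.pairwise
    exact h2.imp fun hab h => by simp [h] at hab
  · obtain ⟨l, hl, rfl⟩ := hv
    have := hf e
    rcases eq_or_rank_head_lt_of_isChain hf hc hl he with rfl | h
    · rw [htv] at this; omega
    · rw [htv] at this; omega

end Rank

section Connectivity

variable {α E : Type*} {tail head : E → α} {r v : α}

theorem exists_entering_of_isChain {X : Set α} (hv : v ∈ X) {p : List E}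
    (hc : List.IsChain (fun e f => head e = tail f) p)
    (hr : ∃ e, p.head? = some e ∧ tail e ∉ X) (hl : ∃ e, p.getLast? = some e ∧ head e = v) :
    ∃ e ∈ p, tail e ∉ X ∧ head e ∈ X := by
  induction p with
  | nil => simp at hr
  | cons a q ih =>
    have ha : tail a ∉ X := by simpa using hr
    by_cases hX : head a ∈ X
    · exact ⟨a, by simp, ha, hX⟩
    · cases q with
      | nil =>
        obtain ⟨e, he, rfl⟩ := hl
        simp only [List.getLast?_singleton, Option.some.injEq] at he
        exact absurd (he ▸ hv) hX
      | cons b t =>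
        obtain ⟨hab, hc'⟩ := List.isChain_cons_cons.1 hc
        obtain ⟨e, he, h⟩ := ih hc' ⟨b, rfl, hab ▸ hX⟩ (by simpa using hl)
        exact ⟨e, List.mem_cons_of_mem _ he, h⟩

/-- Weak duality: edge-disjoint paths into `X` need distinct entering edges. -/
theorem le_rho_of_hasEDPaths [Finite E] {A : Set E} {n : ℕ}
    (h : HasEDPaths tail head A r v n) {X : Set α} (hv : v ∈ X) (hr : r ∉ X) :
    n ≤ rho tail head A X := by
  obtain ⟨P, hP, hd⟩ := h
  have key : ∀ i, ∃ e ∈ P i, tail e ∉ X ∧ head e ∈ X := fun i => by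
    obtain ⟨-, hc, -, -, ⟨a, ha, rfl⟩, hl⟩ := hP i
    exact exists_entering_of_isChain hv hc ⟨a, ha, hr⟩ hl
  choose g hg hgX using key
  have hinj : Set.InjOn g Set.univ := fun i _ j _ hij => by
    by_contra hne
    exact hd i j hne _ (hg i) (hij ▸ hg j)
  have := Set.ncard_le_ncard_of_injOn (t := {e ∈ A | tail e ∉ X ∧ head e ∈ X}) g
    (fun i _ => ⟨(hP i).1 _ (hg i), hgX i⟩) hinj
  simpa [rho, Set.ncard_univ] using this

theorem bddAbove_hasEDPaths [Finite E] (A : Set E) :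
    BddAbove {n | HasEDPaths tail head A r v n} := by
  refine ⟨Nat.card E, fun n hn => ?_⟩
  obtain ⟨P, hP, hd⟩ := hn
  have key : ∀ i, ∃ e, e ∈ P i := fun i => by
    obtain ⟨-, -, -, -, ⟨a, ha, -⟩, -⟩ := hP i
    exact ⟨a, List.mem_of_head? ha⟩
  choose g hg using key
  have hinj : Function.Injective g := fun i j hij => by
    by_contra hne
    exact hd i j hne _ (hg i) (hij ▸ hg j)
  simpa using Nat.card_le_card_of_injective g hinj

theorem le_lam_of_hasEDPaths [Finite E] {A : Set E} {n : ℕ}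
    (h : HasEDPaths tail head A r v n) : n ≤ lam tail head A r v :=
  le_csSup (bddAbove_hasEDPaths A) h

theorem hasEDPaths_lam [Finite E] (A : Set E) :
    HasEDPaths tail head A r v (lam tail head A r v) :=
  Nat.sSup_mem (s := {n | HasEDPaths tail head A r v n})
    ⟨0, Fin.elim0, fun i => i.elim0, fun i => i.elim0⟩ (bddAbove_hasEDPaths A)

theorem HasEDPaths.mono {A B : Set E} (hAB : A ⊆ B) {n : ℕ}
    (h : HasEDPaths tail head A r v n) : HasEDPaths tail head B r v n := by
  obtain ⟨P, hP, hd⟩ := h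
  exact ⟨P, fun i => ⟨fun e he => hAB ((hP i).1 e he), (hP i).2⟩, hd⟩

theorem lam_mono [Finite E] {A B : Set E} (hAB : A ⊆ B) :
    lam tail head A r v ≤ lam tail head B r v :=
  le_lam_of_hasEDPaths ((hasEDPaths_lam A).mono hAB)

theorem rho_mono [Finite E] {A B : Set E} (hAB : A ⊆ B) (X : Set α) :
    rho tail head A X ≤ rho tail head B X :=
  Set.ncard_le_ncard fun _ he => ⟨hAB he.1, he.2⟩

theorem rho_union_add_rho_inter_le [Finite E] (A : Set E) (X Y : Set α) :
    rho tail head A (X ∪ Y) + rho tail head A (X ∩ Y) ≤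
      rho tail head A X + rho tail head A Y := by
  unfold rho
  rw [← Set.ncard_union_add_ncard_inter, ← Set.ncard_union_add_ncard_inter {e ∈ A | _ ∧ head e ∈ X}]
  refine Nat.add_le_add (Set.ncard_le_ncard ?_) (Set.ncard_le_ncard ?_) <;>
    intro e <;> simp only [Set.mem_union, Set.mem_inter_iff, Set.mem_ofPred_eq] <;> tauto

end Connectivity

section Menger

variable {α E : Type*} [Finite E] {tail head : E → α} {r v : α}

/-- In a minimal edge set all of whose cuts separating `v` from `r` have size at least `k`, every
edge enters a set whose cut has size exactly `k`. -/
theorem exists_tight_of_minimal {k : ℕ} {A : Set E}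
    (hA : Minimal (fun B => ∀ X : Set α, v ∈ X → r ∉ X → k ≤ rho tail head B X) A)
    {e : E} (he : e ∈ A) :
    ∃ X : Set α, v ∈ X ∧ r ∉ X ∧ tail e ∉ X ∧ head e ∈ X ∧ rho tail head A X = k := by
  have hnot : ¬ ∀ X : Set α, v ∈ X → r ∉ X → k ≤ rho tail head (A \ {e}) X := fun h =>
    (hA.le_of_le h Set.sdiff_subset he).2 rfl
  push Not at hnot
  obtain ⟨X, hv, hr, hlt⟩ := hnot
  have hk := hA.prop X hv hr
  have hsub : {x ∈ A | tail x ∉ X ∧ head x ∈ X} ⊆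
      insert e {x ∈ A \ {e} | tail x ∉ X ∧ head x ∈ X} := by
    intro x hx
    by_cases hxe : x = e
    · exact Or.inl hxe
    · exact Or.inr ⟨⟨hx.1, hxe⟩, hx.2⟩
  have hle := (Set.ncard_le_ncard hsub).trans (Set.ncard_insert_le _ _)
  have hent : tail e ∉ X ∧ head e ∈ X := by
    by_contra hne
    have : rho tail head A X ≤ rho tail head (A \ {e}) X := by
      refine Set.ncard_le_ncard fun x hx => ⟨⟨hx.1, ?_⟩, hx.2⟩
      rintro rfl
      exact hne hx.2
    omega
  refine ⟨X, hv, hr, hent.1, hent.2, ?_⟩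
  unfold rho at *
  omega

/-- In a minimal edge set all of whose cuts separating `v` from `r` have size at least `k`,
out-degrees do not exceed in-degrees away from `r`. -/
theorem outDeg_le_inDeg_of_minimal [Finite α] {k : ℕ} {A : Set E}
    (hA : Minimal (fun B => ∀ X : Set α, v ∈ X → r ∉ X → k ≤ rho tail head B X) A)
    {w : α} (hw : w ≠ r) :
    {e ∈ A | tail e = w}.ncard ≤ {e ∈ A | head e = w}.ncard := by
  rcases Set.eq_empty_or_nonempty {e ∈ A | tail e = w} with h0 | ⟨e₀, he₀, rfl⟩
  · simp [h0]
  set w := tail e₀ with hw_def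
  have hex : {Z : Set α | v ∈ Z ∧ r ∉ Z ∧ w ∉ Z ∧ rho tail head A Z = k}.Nonempty := by
    obtain ⟨X, h1, h2, h3, -, h5⟩ := exists_tight_of_minimal hA he₀
    exact ⟨X, h1, h2, h3, h5⟩
  obtain ⟨Z, hZ⟩ := (Set.toFinite _).exists_maximal hex
  obtain ⟨hvZ, hrZ, hwZ, hkZ⟩ := hZ.prop
  have hout : {e ∈ A | tail e = w} ⊆ {e ∈ A | tail e ∉ Z ∧ head e ∈ Z} := by
    rintro e ⟨heA, hew⟩
    obtain ⟨X, h1, h2, h3, h4, h5⟩ := exists_tight_of_minimal hA heA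
    have hsm := rho_union_add_rho_inter_le (tail := tail) (head := head) A Z X
    have hu := hA.prop (Z ∪ X) (Or.inl hvZ) (by simp [hrZ, h2])
    have hi := hA.prop (Z ∩ X) ⟨hvZ, h1⟩ (by simp [hrZ])
    rw [hew] at h3
    have hmem : v ∈ Z ∪ X ∧ r ∉ Z ∪ X ∧ w ∉ Z ∪ X ∧ rho tail head A (Z ∪ X) = k :=
      ⟨Or.inl hvZ, by simp [hrZ, h2], by simp [hwZ, h3], by omega⟩
    exact ⟨heA, hew ▸ hwZ, hZ.le_of_ge hmem Set.subset_union_left (Or.inr h4)⟩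
  have hins := hA.prop (insert w Z) (Set.mem_insert_of_mem _ hvZ) (by simp [hrZ, hw.symm])
  have hsub : {e ∈ A | tail e ∉ insert w Z ∧ head e ∈ insert w Z} ⊆
      ({e ∈ A | tail e ∉ Z ∧ head e ∈ Z} \ {e ∈ A | tail e = w}) ∪ {e ∈ A | head e = w} := by
    rintro e ⟨heA, h1, h2⟩
    simp only [Set.mem_insert_iff, not_or] at h1 h2
    rcases h2 with h2 | h2
    · exact Or.inr ⟨heA, h2⟩
    · exact Or.inl ⟨⟨heA, h1.2, h2⟩, fun h => h1.1 h.2⟩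
  have h1 := (Set.ncard_le_ncard hsub).trans (Set.ncard_union_le _ _)
  have h2 := Set.ncard_sdiff_add_ncard_of_subset hout
  unfold rho at hins hkZ
  omega

/-- Edge sets whose out-degrees do not exceed the in-degrees away from `r` have, in a ranked
digraph, edge-disjoint paths from `r` ending in the edges with head `v`. -/
theorem hasEDPaths_of_outDeg_le_inDeg {f : α → ℕ} (hf : ∀ e, f (tail e) < f (head e))
    {A : Set E} {k : ℕ}
    (hdeg : ∀ w, w ≠ r → {e ∈ A | tail e = w}.ncard ≤ {e ∈ A | head e = w}.ncard)
    (hout : ∀ e ∈ A, tail e ≠ v) (hk : k ≤ {e ∈ A | head e = v}.ncard) :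
    HasEDPaths tail head A r v k := by
  rcases isEmpty_or_nonempty E with hE | hE
  · have : k = 0 := by simpa [Set.eq_empty_of_isEmpty] using hk
    subst this
    exact ⟨Fin.elim0, fun i => i.elim0, fun i => i.elim0⟩
  have hg : ∀ w, ∃ g : E → E, w ≠ r →
      (∀ e ∈ {e ∈ A | tail e = w}, g e ∈ {e ∈ A | head e = w}) ∧
        Set.InjOn g {e ∈ A | tail e = w} := by
    intro w
    by_cases hw : w = r
    · exact ⟨id, fun h => absurd hw h⟩
    · have hle : {e ∈ A | tail e = w}.encard ≤ {e ∈ A | head e = w}.encard := by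
        rw [← Set.Finite.cast_ncard_eq (Set.toFinite _),
          ← Set.Finite.cast_ncard_eq (Set.toFinite _)]
        exact_mod_cast hdeg w hw
      obtain ⟨g, h1, h2⟩ := (Set.toFinite _).exists_injOn_of_encard_le hle
      exact ⟨g, fun _ => ⟨h1, h2⟩⟩
  choose g hg using hg
  -- `Pred x y`: the path through `y` uses `x` just before `y`
  let Pred : E → E → Prop := fun x y => y ∈ A ∧ tail y ≠ r ∧ g (tail y) y = x
  have hPred : ∀ {x y}, Pred x y → x ∈ A ∧ head x = tail y := by
    rintro x y ⟨hy, hyr, rfl⟩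
    exact (hg _ hyr).1 y ⟨hy, rfl⟩
  have hru : Relator.RightUnique Pred := by
    intro x y z hy hz
    have htail : tail z = tail y := (hPred hz).2.symm.trans (hPred hy).2
    refine (hg _ hy.2.1).2 ⟨hy.1, rfl⟩ ⟨hz.1, htail⟩ ?_
    rw [hy.2.2, ← htail, hz.2.2]
  have hpath : ∀ n, ∀ e ∈ A, f (tail e) = n → ∃ p : List E,
      List.IsChain (fun e f => head e = tail f) p ∧ (∃ a, p.head? = some a ∧ tail a = r) ∧
      p.getLast? = some e ∧ ∀ x ∈ p, x ∈ A ∧ Relation.ReflTransGen Pred x e := by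
    intro n
    induction n using Nat.strong_induction_on with
    | _ n ih =>
      intro e he hn
      by_cases her : tail e = r
      · exact ⟨[e], by simp, ⟨e, rfl, her⟩, rfl, by simpa using ⟨he, Relation.ReflTransGen.refl⟩⟩
      · have hpe : Pred (g (tail e) e) e := ⟨he, her, rfl⟩
        obtain ⟨hA', hh⟩ := hPred hpe
        have hlt : f (tail (g (tail e) e)) < n := (hf _).trans_eq ((congrArg f hh).trans hn)
        obtain ⟨p, hc, ⟨a, ha, har⟩, hl, hx⟩ := ih _ hlt _ hA' rfl
        refine ⟨p ++ [e], ?_, ⟨a, by simp [ha], har⟩, by simp, ?_⟩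
        · refine List.isChain_append.2 ⟨hc, by simp, fun x hx y hy => ?_⟩
          simp only [hl, Option.mem_def, Option.some.injEq, List.head?_cons] at hx hy
          rw [← hx, ← hy, hh]
        · intro x hxp
          rcases List.mem_append.1 hxp with h | h
          · exact ⟨(hx x h).1, (hx x h).2.tail hpe⟩
          · obtain rfl : x = e := by simpa using h
            exact ⟨he, Relation.ReflTransGen.refl⟩
  choose! P hP using fun e he => hpath _ e he rfl
  obtain ⟨t, ht, htk⟩ := Set.exists_subset_card_eq hk
  have hcard : Nat.card t = k := htk
  let em : Fin k ≃ t := (Finite.equivFinOfCardEq hcard).symm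
  have hem : ∀ i, (em i : E) ∈ A ∧ head (em i : E) = v := fun i => ht (em i).2
  have last : ∀ {a b : E}, a ∈ A → head a = v → Relation.ReflTransGen Pred a b → a = b := by
    intro a b _ hav hab
    rcases Relation.ReflTransGen.cases_head hab with h | ⟨c, hac, -⟩
    · exact h
    · exact absurd ((hPred hac).2.symm.trans hav) (hout c hac.1)
  refine ⟨fun i => P (em i), fun i => ?_, fun i j hij e hi hj => hij ?_⟩
  · obtain ⟨hc, hr, hl, hx⟩ := hP _ (hem i).1
    exact isRVPath_of_isChain hf (fun e he => (hx e he).1) hc hr ⟨_, hl, (hem i).2⟩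
  · have h1 := ((hP _ (hem i).1).2.2.2 e hi).2
    have h2 := ((hP _ (hem j).1).2.2.2 e hj).2
    apply em.injective
    apply Subtype.ext
    rcases h1.total_of_right_unique hru h2 with h | h
    · exact last (hem i).1 (hem i).2 h
    · exact (last (hem j).1 (hem j).2 h).symm

/-- Menger's theorem (edge version) for ranked rooted digraphs. -/
theorem hasEDPaths_of_forall_le_rho [Finite α] {f : α → ℕ} (hf : ∀ e, f (tail e) < f (head e))
    (hvr : v ≠ r) {A : Set E} {k : ℕ}
    (h : ∀ X : Set α, v ∈ X → r ∉ X → k ≤ rho tail head A X) :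
    HasEDPaths tail head A r v k := by
  obtain ⟨B, hBA, hB⟩ := (Set.toFinite
    {B : Set E | ∀ X : Set α, v ∈ X → r ∉ X → k ≤ rho tail head B X}).exists_le_minimal h
  refine HasEDPaths.mono hBA (hasEDPaths_of_outDeg_le_inDeg hf
    (fun w hw => outDeg_le_inDeg_of_minimal hB hw) (fun e he hev => ?_) ?_)
  · obtain ⟨X, hv, -, ht, -⟩ := exists_tight_of_minimal hB he
    exact ht (hev ▸ hv)
  · refine (hB.prop {v} rfl (by simpa using hvr.symm)).trans (Set.ncard_le_ncard ?_)
    exact fun e he => ⟨he.1, he.2.2⟩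

theorem exists_rho_le_lam [Finite α] {f : α → ℕ} (hf : ∀ e, f (tail e) < f (head e))
    (hvr : v ≠ r) (A : Set E) :
    ∃ X : Set α, v ∈ X ∧ r ∉ X ∧ rho tail head A X ≤ lam tail head A r v := by
  by_contra! h
  exact absurd (le_lam_of_hasEDPaths (hasEDPaths_of_forall_le_rho hf hvr h)) (by omega)

end Menger

section Base

variable {α E : Type*} [Finite E] {tail head : E → α} {r u v : α}

/-- Deleting edges with head `u` while keeping `k` edge-disjoint paths to `u`, where `k` is the size
of some cut separating `u` from `r`, does not decrease the connectivity to any vertex. -/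
theorem le_rho_of_hasEDPaths_of_sdiff_head {A B : Set E} (hBA : B ⊆ A)
    (hhead : ∀ e ∈ A, e ∉ B → head e = u) {k m : ℕ} (hu : HasEDPaths tail head B r u k)
    {Y : Set α} (huY : u ∈ Y) (hrY : r ∉ Y) (hY : rho tail head A Y ≤ k)
    (hA : ∀ X : Set α, v ∈ X → r ∉ X → m ≤ rho tail head A X)
    {X : Set α} (hvX : v ∈ X) (hrX : r ∉ X) : m ≤ rho tail head B X := by
  by_cases huX : u ∈ X
  · have hBY := le_rho_of_hasEDPaths hu huY hrY
    have hBXY := le_rho_of_hasEDPaths hu (X := X ∩ Y) ⟨huX, huY⟩ (by simp [hrX])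
    have hsm := rho_union_add_rho_inter_le (tail := tail) (head := head) B X Y
    have hYm := rho_mono (tail := tail) (head := head) hBA Y
    have hent : {e ∈ B | tail e ∉ Y ∧ head e ∈ Y} = {e ∈ A | tail e ∉ Y ∧ head e ∈ Y} :=
      Set.eq_of_subset_of_ncard_le (fun e he => ⟨hBA he.1, he.2⟩) (hY.trans hBY)
    have hunion : rho tail head A (X ∪ Y) ≤ rho tail head B (X ∪ Y) := by
      refine Set.ncard_le_ncard fun e he => ⟨?_, he.2⟩
      by_contra heB
      have heY : e ∈ {e ∈ A | tail e ∉ Y ∧ head e ∈ Y} :=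
        ⟨he.1, fun h => he.2.1 (Or.inr h), hhead e he.1 heB ▸ huY⟩
      exact heB (hent ▸ heY).1
    have hm := hA (X ∪ Y) (Or.inl hvX) (by simp [hrX, hrY])
    omega
  · refine (hA X hvX hrX).trans (Set.ncard_le_ncard fun e he => ⟨?_, he.2⟩)
    by_contra heB
    exact huX (hhead e he.1 heB ▸ he.2.2)

theorem lam_le_rho_of_forall_base [Finite α] {f : α → ℕ} (hf : ∀ e, f (tail e) < f (head e))
    {F : Set E} (hF : ∀ v, v ≠ r → GammoidIndep tail head r v (F ∩ {e | head e = v}) ∧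
      (F ∩ {e | head e = v}).ncard = lam tail head Set.univ r v)
    {X : Set α} (hvr : v ≠ r) (hvX : v ∈ X) (hrX : r ∉ X) :
    lam tail head Set.univ r v ≤ rho tail head F X := by
  classical
  have := Fintype.ofFinite α
  have key : ∀ S : Finset α, ∀ v, v ≠ r → ∀ X : Set α, v ∈ X → r ∉ X →
      lam tail head Set.univ r v ≤
        rho tail head {e | head e ∈ S → head e ≠ r → e ∈ F} X := by
    intro S
    induction S using Finset.induction_on_min_value f with
    | empty =>
      intro v _ X hv hr
      simpa using le_rho_of_hasEDPaths (hasEDPaths_lam Set.univ) hv hr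
    | insert u S _ hmin ih =>
      intro v hv X hvX hrX
      by_cases hur : u = r
      · refine (ih v hv X hvX hrX).trans (rho_mono ?_ X)
        intro e he heS her
        refine he ?_ her
        exact (Finset.mem_insert.1 heS).resolve_left (hur ▸ her)
      obtain ⟨Y, huY, hrY, hY⟩ := exists_rho_le_lam hf hur (Set.univ : Set E)
      have hpaths : HasEDPaths tail head {e | head e ∈ insert u S → head e ≠ r → e ∈ F} r u
          (lam tail head Set.univ r u) := by
        obtain ⟨⟨P, hP, hd, hlast⟩, hcard⟩ := hF u hur
        rw [← hcard]
        refine ⟨P, fun i => ⟨fun e he heS _ => ?_, (hP i).2⟩, hd⟩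
        obtain ⟨-, hc, -, -, -, ⟨l, hl, hlu⟩⟩ := hP i
        rcases eq_or_rank_head_lt_of_isChain hf hc hl he with rfl | hlt
        · exact ((hlast e).2 ⟨i, hl⟩).1
        · rw [hlu] at hlt
          rcases Finset.mem_insert.1 heS with h | h
          · rw [h] at hlt; omega
          · have := hmin _ h; omega
      refine le_rho_of_hasEDPaths_of_sdiff_head (A := {e | head e ∈ S → head e ≠ r → e ∈ F})
        ?_ (fun e he heB => ?_) hpaths huY hrY
        ((rho_mono (Set.subset_univ _) Y).trans hY) (ih v hv) hvX hrX
      · intro e he heS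
        exact he (Finset.mem_insert_of_mem heS)
      by_contra hne
      exact heB fun heS => he ((Finset.mem_insert.1 heS).resolve_left hne)
  refine (key Finset.univ v hvr (X := X) hvX hrX).trans (Set.ncard_le_ncard fun e he => ?_)
  exact ⟨he.1 (Finset.mem_univ _) fun h => hrX (h ▸ he.2.2), he.2⟩

/-- Edge-disjoint paths inside `F`, as many as there are edges of `F` with head `v`, use all these
edges as last edges. -/
theorem gammoidIndep_of_hasEDPaths {F : Set E}
    (h : HasEDPaths tail head F r v (F ∩ {e | head e = v}).ncard) :
    GammoidIndep tail head r v (F ∩ {e | head e = v}) := by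
  obtain ⟨P, hP, hd⟩ := h
  have hlast : ∀ i, ∃ e, (P i).getLast? = some e ∧ head e = v := fun i => (hP i).2.2.2.2.2
  choose g hg hgv using hlast
  have hmem : ∀ i, g i ∈ P i := fun i => List.mem_of_getLast? (hg i)
  have hinj : Function.Injective g := fun i j hij => by
    by_contra hne
    exact hd i j hne _ (hmem i) (hij ▸ hmem j)
  have hrange : Set.range g = F ∩ {e | head e = v} := by
    refine Set.eq_of_subset_of_ncard_le ?_ ?_
    · rintro _ ⟨i, rfl⟩
      exact ⟨(hP i).1 _ (hmem i), hgv i⟩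
    · rw [← Set.image_univ, Set.ncard_image_of_injective _ hinj, Set.ncard_univ, Nat.card_fin]
  refine ⟨P, fun i => ⟨fun _ _ => trivial, (hP i).2⟩, hd, fun e => ?_⟩
  have he : e ∈ F ∩ {e | head e = v} ↔ ∃ i, g i = e := (Set.ext_iff.1 hrange e).symm
  exact he.trans (exists_congr fun i => by rw [hg i, Option.some.injEq])

end Base

/-- if `D` is acyclic, then `F ⊆ E` is a maximal flame of `D` if
and only if `F ∩ in_D(v)` is a base of the gammoid `G_D(v)` (an independent set
of size `λ_D(r,v)`) for every `v ∈ V`, i.e. iff `F` is a base of the direct sum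
matroid `M = ⋃_{v ∈ V} G_D(v)`. -/
theorem acyclic_maximal_flame_iff_base
    {α E : Type*} [Fintype α] [Fintype E] (tail head : E → α) (r : α)
    (hacyc : ∀ p : List E, ¬ IsDicycle tail head Set.univ p) (F : Set E) :
    IsMaxFlameIn tail head Set.univ r F ↔
      ∀ v, v ≠ r →
        GammoidIndep tail head r v (F ∩ {e | head e = v}) ∧
        (F ∩ {e | head e = v}).ncard = lam tail head Set.univ r v := by
  obtain ⟨f, hf⟩ := exists_rank hacyc
  constructor
  · rintro ⟨-, h⟩ v hv
    obtain ⟨h1, h2⟩ := h v hv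
    have hcard : lam tail head F r v = (F ∩ {e | head e = v}).ncard := h2
    exact ⟨gammoidIndep_of_hasEDPaths (hcard ▸ hasEDPaths_lam F), hcard.symm.trans h1.symm⟩
  · intro h
    refine ⟨Set.subset_univ F, fun v hv => ?_⟩
    have hle : lam tail head Set.univ r v ≤ lam tail head F r v :=
      le_lam_of_hasEDPaths (hasEDPaths_of_forall_le_rho hf hv
        fun X hvX hrX => lam_le_rho_of_forall_base hf h hv hvX hrX)
    have heq := le_antisymm hle (lam_mono (Set.subset_univ F))
    exact ⟨heq, heq.symm.trans (h v hv).2.symm⟩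
end

section
/- Let D = (V+r, E) be a rooted digraph, let m = max_{v ∈ V} λ_D(r,v) ≥ 1 and V_m = {v ∈ V : λ_D(r,v) = m}. Then there exists a branching B in D whose head-set is V_m such that λ_{D−B}(r,v) = λ_D(r,v) for every v ∈ V \ V_m and λ_{D−B}(r,v) ≥ m − 1 for every v ∈ V_m, where D − B is the digraph obtained from D by deleting the edges of B. -/
section RootedDigraph

variable {α E : Type*} {tail head : E → α} {F G B : Set E} {r u v : α}

theorem rho_sdiff_singleton_of_not_entering {e : E} {X : Set α}
    (h : ¬ (tail e ∉ X ∧ head e ∈ X)) :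
    rho tail head (F \ {e}) X = rho tail head F X := by
  unfold rho
  congr 1
  ext f
  simp only [Set.mem_ofPred_eq, Set.mem_sdiff, Set.mem_singleton_iff]
  constructor
  · tauto
  · rintro ⟨h1, h2⟩
    exact ⟨⟨h1, fun hf => h (hf ▸ h2)⟩, h2⟩

section Cuts

variable [Finite E]

theorem rho_mono_s14 (hFG : F ⊆ G) (X : Set α) : rho tail head F X ≤ rho tail head G X :=
  Set.ncard_le_ncard (fun _ he => ⟨hFG he.1, he.2⟩) (Set.toFinite _)

theorem rho_inter_add_rho_union_le (tail head : E → α) (F : Set E) (X Y : Set α) :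
    rho tail head F (X ∩ Y) + rho tail head F (X ∪ Y) ≤
      rho tail head F X + rho tail head F Y := by
  unfold rho
  rw [← Set.ncard_union_add_ncard_inter _ _ (Set.toFinite _) (Set.toFinite _),
    ← Set.ncard_union_add_ncard_inter {e ∈ F | tail e ∉ X ∧ head e ∈ X} _
      (Set.toFinite _) (Set.toFinite _)]
  refine add_le_add (Set.ncard_le_ncard ?_ (Set.toFinite _))
    (Set.ncard_le_ncard ?_ (Set.toFinite _)) <;>
  · intro e he
    simp only [Set.mem_union, Set.mem_inter_iff, Set.mem_ofPred_eq] at he ⊢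
    tauto

theorem rho_le_rho_sdiff_singleton_add_one (tail head : E → α) (F : Set E) (e : E) (X : Set α) :
    rho tail head F X ≤ rho tail head (F \ {e}) X + 1 := by
  unfold rho
  refine le_trans (Set.ncard_le_ncard ?_ (Set.toFinite _)) (Set.ncard_insert_le e _)
  intro f hf
  by_cases h : f = e
  · exact Or.inl h
  · exact Or.inr ⟨⟨hf.1, h⟩, hf.2⟩

/-- Some edge of `F` runs from `X \ W` to `X ∩ W` if fewer edges enter `X` than `X ∩ W`. -/
theorem exists_edge_of_rho_lt_rho_inter {X W : Set α}
    (h : rho tail head F X < rho tail head F (X ∩ W)) :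
    ∃ e ∈ F, tail e ∈ X ∧ tail e ∉ W ∧ head e ∈ X ∧ head e ∈ W := by
  by_contra! hc
  refine h.not_ge (Set.ncard_le_ncard ?_ (Set.toFinite _))
  rintro e ⟨he, ht, hX, hW⟩
  exact ⟨he, fun htX => hc e he htX (fun htW => ht ⟨htX, htW⟩) hX hW, hX⟩

end Cuts

section Paths

theorem exists_entering_edge {X : Set α} :
    ∀ {p : List E} {u : α}, List.IsChain (fun e f => head e = tail f) p →
      (∃ e, p.head? = some e ∧ tail e = u) → (∃ e, p.getLast? = some e ∧ head e = v) →
      u ∉ X → v ∈ X → ∃ e ∈ p, tail e ∉ X ∧ head e ∈ X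
  | [], _, _, h, _, _, _ => by simp at h
  | [e], u, _, h1, h2, hu, hv => by
    simp only [List.head?_cons, List.getLast?_singleton, Option.some.injEq,
      exists_eq_left'] at h1 h2
    exact ⟨e, by simp, h1 ▸ hu, h2 ▸ hv⟩
  | e :: f :: l, u, hc, h1, h2, hu, hv => by
    simp only [List.head?_cons, Option.some.injEq, exists_eq_left'] at h1
    rw [List.isChain_cons_cons] at hc
    by_cases he : head e ∈ X
    · exact ⟨e, by simp, h1 ▸ hu, he⟩
    · obtain ⟨g, hg, hgX⟩ := exists_entering_edge hc.2 ⟨f, rfl, hc.1.symm⟩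
        (by simpa using h2) he hv
      exact ⟨g, List.mem_cons_of_mem _ hg, hgX⟩

theorem IsRVPath.mono {p : List E} (h : IsRVPath tail head F r v p) (hFG : F ⊆ G) :
    IsRVPath tail head G r v p :=
  ⟨fun e he => hFG (h.1 e he), h.2⟩

theorem isRVPath_singleton {e : E} (he : e ∈ F) (hne : tail e ≠ head e) :
    IsRVPath tail head F (tail e) (head e) [e] := by
  refine ⟨by simpa using he, List.isChain_singleton _, by simp, by simpa using hne,
    ⟨e, rfl, rfl⟩, ⟨e, rfl, rfl⟩⟩

/-- Prepending an edge to a path and cutting off a possible closed walk yields a path. -/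
theorem IsRVPath.exists_cons {e : E} {p : List E} (h : IsRVPath tail head F (head e) v p)
    (he : e ∈ F) (hne : tail e ≠ v) :
    ∃ q, IsRVPath tail head F (tail e) v q ∧ ∀ f ∈ q, f = e ∨ f ∈ p := by
  obtain ⟨hF, hc, hnd, htv, ⟨a, ha, hae⟩, ⟨b, hb, hbv⟩⟩ := h
  by_cases hu : tail e ∈ p.map tail
  · obtain ⟨f, hf, hfe⟩ := List.mem_map.1 hu
    obtain ⟨l₁, l₂, rfl⟩ := List.append_of_mem hf
    refine ⟨f :: l₂, ⟨fun g hg => hF g (List.mem_append_right _ hg), hc.right_of_append, ?_,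
      fun g hg => htv g (List.mem_append_right _ hg), ⟨f, rfl, hfe⟩, ⟨b, ?_, hbv⟩⟩,
      fun g hg => Or.inr (List.mem_append_right _ hg)⟩
    · rw [List.map_append] at hnd
      exact hnd.of_append_right
    · rwa [List.getLast?_append_of_ne_nil _ (by simp)] at hb
  · cases p with
    | nil => simp at ha
    | cons c l =>
      obtain rfl : c = a := by simpa using ha
      refine ⟨e :: c :: l, ⟨?_, List.isChain_cons_cons.2 ⟨hae.symm, hc⟩, ?_, ?_,
        ⟨e, rfl, rfl⟩, ⟨b, by simpa using hb, hbv⟩⟩, fun f hf => List.mem_cons.1 hf⟩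
      · rintro g (_ | ⟨_, hg⟩)
        exacts [he, hF g hg]
      · rw [List.map_cons]
        exact List.nodup_cons.2 ⟨hu, hnd⟩
      · rintro g (_ | ⟨_, hg⟩)
        exacts [hne, htv g hg]

end Paths

section Menger

variable [Finite E]

theorem HasEDPaths.le_rho {n : ℕ} (h : HasEDPaths tail head F r v n) {X : Set α}
    (hv : v ∈ X) (hr : r ∉ X) : n ≤ rho tail head F X := by
  obtain ⟨P, hP, hdisj⟩ := h
  have hent (i) : ∃ e ∈ P i, tail e ∉ X ∧ head e ∈ X :=
    exists_entering_edge (hP i).2.1 (hP i).2.2.2.2.1 (hP i).2.2.2.2.2 hr hv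
  choose f hfP hfX using hent
  have hinj : Function.Injective f := fun i j hij => by
    by_contra hne
    exact hdisj i j hne (f i) (hfP i) (hij ▸ hfP j)
  have hsub : Set.range f ⊆ {e ∈ F | tail e ∉ X ∧ head e ∈ X} := by
    rintro _ ⟨i, rfl⟩
    exact ⟨(hP i).1 _ (hfP i), hfX i⟩
  calc n = (Set.range f).ncard := by
        rw [← Set.image_univ, Set.ncard_image_of_injective _ hinj, Set.ncard_univ, Nat.card_fin]
    _ ≤ _ := Set.ncard_le_ncard hsub (Set.toFinite _)

/-- If the cuts allow `k` units of flow from `r` to `v` together with one more unit from `u`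
to `v`, then a path from `u` to `v` can be removed so that they still allow `k` units of flow
from `r` to `v`. -/
theorem exists_isRVPath_of_cut_le [Finite α] (k : ℕ) (huv : u ≠ v)
    (h : ∀ X : Set α, v ∈ X → (r ∉ X → k ≤ rho tail head G X) ∧
      (u ∉ X → 1 ≤ rho tail head G X) ∧ (r ∉ X → u ∉ X → k + 1 ≤ rho tail head G X)) :
    ∃ p, IsRVPath tail head G u v p ∧
      ∀ X : Set α, v ∈ X → r ∉ X → k ≤ rho tail head (G \ {e | e ∈ p}) X := by
  induction G using WellFoundedLT.induction generalizing u with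
  | ind G ih =>
  let tight : Set (Set α) := {X | v ∈ X ∧ u ∈ X ∧
    ((r ∈ X ∧ rho tail head G X = 0) ∨ (r ∉ X ∧ rho tail head G X = k))}
  have huniv : Set.univ ∈ tight := ⟨trivial, trivial, Or.inl ⟨trivial, by simp [rho]⟩⟩
  obtain ⟨T, hT⟩ := (Set.toFinite tight).exists_minimal ⟨_, huniv⟩
  have hTle : ∀ X ∈ tight, T ⊆ X := by
    intro X hX
    refine Set.inter_eq_left.1 (Set.Subset.antisymm Set.inter_subset_left
      (hT.2 ?_ Set.inter_subset_left))
    obtain ⟨hvT, huT, hT'⟩ := hT.1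
    obtain ⟨hvX, huX, hX'⟩ := hX
    refine ⟨⟨hvT, hvX⟩, ⟨huT, huX⟩, ?_⟩
    have hsub := rho_inter_add_rho_union_le tail head G T X
    have h1 := (h (T ∩ X) ⟨hvT, hvX⟩).1
    have h2 := (h (T ∪ X) (Or.inl hvT)).1
    rcases hT' with ⟨hrT, hT'⟩ | ⟨hrT, hT'⟩ <;> rcases hX' with ⟨hrX, hX'⟩ | ⟨hrX, hX'⟩
    · exact Or.inl ⟨⟨hrT, hrX⟩, by omega⟩
    · have := h1 fun hr => hrX hr.2
      exact Or.inr ⟨fun hr => hrX hr.2, by omega⟩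
    · have := h1 fun hr => hrT hr.1
      exact Or.inr ⟨fun hr => hrT hr.1, by omega⟩
    · have := h1 fun hr => hrT hr.1
      have := h2 fun hr => hr.elim hrT hrX
      exact Or.inr ⟨fun hr => hrT hr.1, by omega⟩
  obtain ⟨e, heG, heu, heT⟩ : ∃ e ∈ G, tail e = u ∧ head e ∈ T := by
    by_contra! hc
    obtain ⟨hvT, huT, hT'⟩ := hT.1
    have hle : rho tail head G (T \ {u}) ≤ rho tail head G T := by
      refine Set.ncard_le_ncard ?_ (Set.toFinite _)
      rintro e ⟨he, ht, hh⟩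
      exact ⟨he, fun htT => ht ⟨htT, fun hu => hc e he hu hh.1⟩, hh.1⟩
    have h1 := h (T \ {u}) ⟨hvT, huv.symm⟩
    have hu : u ∉ T \ {u} := by simp
    rcases hT' with ⟨-, h0⟩ | ⟨hr, h0⟩
    · have := h1.2.1 hu
      omega
    · have := h1.2.2 (fun hr' => hr hr'.1) hu
      omega
  subst heu
  by_cases hev : head e = v
  · subst hev
    refine ⟨[e], isRVPath_singleton heG huv, fun X hvX hrX => ?_⟩
    have hset : {f | f ∈ [e]} = ({e} : Set E) := by ext; simp
    rw [hset]
    by_cases hu : tail e ∈ X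
    · rw [rho_sdiff_singleton_of_not_entering (by tauto)]
      exact (h X hvX).1 hrX
    · have h1 := (h X hvX).2.2 hrX hu
      have h2 := rho_le_rho_sdiff_singleton_add_one tail head G e X
      omega
  · have hlt : G \ {e} < G := Set.sdiff_singleton_ssubset.2 heG
    obtain ⟨p, hp, hpX⟩ := ih (G \ {e}) hlt hev (fun X hvX => by
      have h1 := h X hvX
      have h2 := rho_le_rho_sdiff_singleton_add_one tail head G e X
      by_cases hent : tail e ∉ X ∧ head e ∈ X
      · refine ⟨fun hr => ?_, fun hw => absurd hent.2 hw, fun _ hw => absurd hent.2 hw⟩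
        have := h1.2.2 hr hent.1
        omega
      · rw [rho_sdiff_singleton_of_not_entering hent]
        by_cases hu : tail e ∈ X
        · refine ⟨h1.1, fun hw => ?_, fun hr hw => ?_⟩
          · by_contra hlt
            by_cases hr : r ∈ X
            · exact hw (hTle X ⟨hvX, hu, Or.inl ⟨hr, by omega⟩⟩ heT)
            · have := h1.1 hr
              exact hw (hTle X ⟨hvX, hu, Or.inr ⟨hr, by omega⟩⟩ heT)
          · by_contra hlt
            have := h1.1 hr
            exact hw (hTle X ⟨hvX, hu, Or.inr ⟨hr, by omega⟩⟩ heT)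
        · exact ⟨h1.1, fun _ => h1.2.1 hu, fun hr _ => h1.2.2 hr hu⟩)
    obtain ⟨q, hq, hqp⟩ := (hp.mono Set.sdiff_subset).exists_cons heG huv
    refine ⟨q, hq, fun X hvX hrX => (hpX X hvX hrX).trans (rho_mono_s14 ?_ X)⟩
    rintro f ⟨⟨hf, hfe⟩, hfp⟩
    exact ⟨hf, fun hfq => (hqp f hfq).elim hfe hfp⟩

theorem hasEDPaths_of_le_rho [Finite α] (hvr : v ≠ r) (n : ℕ)
    (h : ∀ X : Set α, v ∈ X → r ∉ X → n ≤ rho tail head F X) :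
    HasEDPaths tail head F r v n := by
  induction n generalizing F with
  | zero => exact ⟨Fin.elim0, fun i => i.elim0, fun i => i.elim0⟩
  | succ k ih =>
    obtain ⟨p, hp, hpX⟩ := exists_isRVPath_of_cut_le (tail := tail) (head := head) (r := r)
      k hvr.symm (fun X hvX => ⟨fun hr => by have := h X hvX hr; omega,
        fun hr => by have := h X hvX hr; omega, fun hr _ => h X hvX hr⟩)
    obtain ⟨P, hP, hdisj⟩ := ih hpX
    refine ⟨Fin.cons p P, fun i => ?_, fun i j => ?_⟩
    · refine Fin.cases ?_ (fun i => ?_) i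
      · simpa using hp
      · simpa using (hP i).mono Set.sdiff_subset
    · refine Fin.cases ?_ (fun i => ?_) i <;> refine Fin.cases ?_ (fun j => ?_) j
      · simp
      · intro _ e he hej
        exact ((hP j).1 e (by simpa using hej)).2 (by simpa using he)
      · intro _ e he hej
        exact ((hP i).1 e (by simpa using he)).2 (by simpa using hej)
      · intro hij e he hej
        exact hdisj i j (fun h => hij (congrArg _ h)) e (by simpa using he) (by simpa using hej)

/-- Menger's theorem for edge-disjoint directed paths. -/
theorem le_lam_iff [Finite α] (hvr : v ≠ r) {n : ℕ} :
    n ≤ lam tail head F r v ↔ ∀ X : Set α, v ∈ X → r ∉ X → n ≤ rho tail head F X := by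
  have hbdd : BddAbove {n | HasEDPaths tail head F r v n} :=
    ⟨rho tail head F {v}, fun n hn => hn.le_rho rfl (fun h => hvr h.symm)⟩
  constructor
  · intro hn X hv hr
    have hmem : HasEDPaths tail head F r v (lam tail head F r v) :=
      Nat.sSup_mem ⟨0, hasEDPaths_of_le_rho hvr 0 (by simp)⟩ hbdd
    exact hn.trans (hmem.le_rho hv hr)
  · exact fun h => le_csSup hbdd (hasEDPaths_of_le_rho hvr n h)

theorem lam_mono_s14 [Finite α] (hvr : v ≠ r) (hFG : F ⊆ G) :
    lam tail head F r v ≤ lam tail head G r v :=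
  (le_lam_iff hvr).2 fun X hv hr => ((le_lam_iff hvr).1 le_rfl X hv hr).trans (rho_mono_s14 hFG X)

end Menger

section Branching

theorem IsDicycle.exists_next {p : List E} (h : IsDicycle tail head F p) {e : E} (he : e ∈ p) :
    ∃ f ∈ p, tail f = head e := by
  obtain ⟨-, -, hc, a, b, ha, hb, hab⟩ := h
  obtain ⟨l₁, l₂, rfl⟩ := List.append_of_mem he
  cases l₂ with
  | nil =>
    obtain rfl : e = b := by simpa using hb
    exact ⟨a, List.mem_of_mem_head? ha, hab.symm⟩
  | cons f l =>
    have := hc.right_of_append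
    rw [List.isChain_cons_cons] at this
    exact ⟨f, by simp, this.1.symm⟩

theorem IsBranching.insert [Finite E] {e : E} (h : IsBranching tail head B)
    (hh : head e ∉ headSet head B) (ht : ∀ f ∈ insert e B, tail f ≠ head e) :
    IsBranching tail head (insert e B) := by
  refine ⟨fun v => ?_, fun p hp => ?_⟩
  · by_cases hv : head e = v
    · subst hv
      refine (Set.ncard_le_one (Set.toFinite _)).2 fun a ha b hb => ?_
      have key : ∀ c ∈ {f ∈ Insert.insert e B | head f = head e}, c = e := fun c hc =>
        hc.1.resolve_right fun hcB => hh ⟨c, hcB, hc.2⟩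
      rw [key a ha, key b hb]
    · refine le_trans (Set.ncard_le_ncard ?_ (Set.toFinite _)) (h.1 v)
      rintro f ⟨rfl | hf, hfv⟩
      exacts [absurd hfv hv, ⟨hf, hfv⟩]
  · have hep : e ∉ p := fun hep => by
      obtain ⟨f, hf, hfe⟩ := hp.exists_next hep
      exact ht f (hp.2.1 f hf) hfe
    exact h.2 p ⟨hp.1, fun f hf => (hp.2.1 f hf).resolve_left fun hfe => hep (hfe ▸ hf), hp.2.2⟩

theorem headSet_insert (head : E → α) (e : E) (B : Set E) :
    headSet head (insert e B) = insert (head e) (headSet head B) := by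
  ext v
  simp [headSet, eq_comm]

/-- The inductive step in the construction of a branching: some edge leads into the uncovered part
`W` of `U` from outside and can be deleted without destroying any of the cut conditions. -/
theorem exists_edge_of_cut_le [Finite α] [Finite E] {U W : Set α} {k : ℕ} (hWU : W ⊆ U)
    (hW : W.Nonempty)
    (hcut : ∀ X : Set α, r ∉ X → (X ∩ U).Nonempty → k ≤ rho tail head F X)
    (hcutW : ∀ X : Set α, X ⊆ W → X.Nonempty → k + 1 ≤ rho tail head F X) :
    ∃ e ∈ F, tail e ∉ W ∧ head e ∈ W ∧
      ∀ X : Set α, r ∉ X → (X ∩ U).Nonempty → k ≤ rho tail head (F \ {e}) X := by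
  let dangerous : Set (Set α) := {X | r ∉ X ∧ (X ∩ W).Nonempty ∧ rho tail head F X = k}
  have hsuff : ∀ e : E, head e ∈ W →
      (∀ Y ∈ dangerous, ¬ (tail e ∉ Y ∧ head e ∈ Y)) →
      ∀ X : Set α, r ∉ X → (X ∩ U).Nonempty → k ≤ rho tail head (F \ {e}) X := by
    intro e he hY X hr hX
    have h1 := hcut X hr hX
    by_cases hent : tail e ∉ X ∧ head e ∈ X
    · have h2 := rho_le_rho_sdiff_singleton_add_one tail head F e X
      have h3 : rho tail head F X ≠ k := fun h => hY X ⟨hr, ⟨_, hent.2, he⟩, h⟩ hent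
      omega
    · rwa [rho_sdiff_singleton_of_not_entering hent]
  by_cases hd : dangerous.Nonempty
  · obtain ⟨X, ⟨hrX, hXW, hX⟩, hmin⟩ := (Set.toFinite dangerous).exists_minimal hd
    obtain ⟨e, heF, htX, htW, hhX, hhW⟩ := exists_edge_of_rho_lt_rho_inter
      (tail := tail) (head := head) (F := F) (X := X) (W := W)
      (by have := hcutW (X ∩ W) Set.inter_subset_right hXW; omega)
    refine ⟨e, heF, htW, hhW, hsuff e hhW ?_⟩
    rintro Y ⟨hrY, hYW, hY⟩ ⟨htY, hhY⟩
    have hsub := rho_inter_add_rho_union_le tail head F X Y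
    have h1 := hcut (X ∩ Y) (fun h => hrX h.1) ⟨head e, ⟨hhX, hhY⟩, hWU hhW⟩
    have h2 := hcut (X ∪ Y) (fun h => h.elim hrX hrY) ⟨head e, Or.inl hhX, hWU hhW⟩
    have hXY : X ∩ Y ∈ dangerous :=
      ⟨fun h => hrX h.1, ⟨head e, ⟨hhX, hhY⟩, hhW⟩, by omega⟩
    exact htY (hmin hXY Set.inter_subset_left htX).2
  · have hpos : 0 < rho tail head F W := by have := hcutW W subset_rfl hW; omega
    obtain ⟨e, heF, ht, hh⟩ := Set.nonempty_of_ncard_ne_zero hpos.ne'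
    exact ⟨e, heF, ht, hh, hsuff e hh fun Y hY => (hd ⟨Y, hY⟩).elim⟩

theorem exists_isBranching_of_cut_le [Finite α] [Finite E] {U : Set α} {k : ℕ} (hrU : r ∉ U)
    (hU : ∀ X : Set α, r ∉ X → (X ∩ U).Nonempty → k + 1 ≤ rho tail head Set.univ X) :
    ∃ B : Set E, IsBranching tail head B ∧ headSet head B = U ∧
      ∀ X : Set α, r ∉ X → (X ∩ U).Nonempty → k ≤ rho tail head (Set.univ \ B) X := by
  suffices key : ∀ W : Set α, W ⊆ U → ∀ B : Set E, IsBranching tail head B →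
      headSet head B = U \ W → (∀ e ∈ B, tail e ∉ W) →
      (∀ X : Set α, r ∉ X → (X ∩ U).Nonempty → k ≤ rho tail head (Set.univ \ B) X) →
      ∃ B : Set E, IsBranching tail head B ∧ headSet head B = U ∧
        ∀ X : Set α, r ∉ X → (X ∩ U).Nonempty → k ≤ rho tail head (Set.univ \ B) X by
    refine key U subset_rfl ∅ ⟨by simp [inDeg], ?_⟩ (by simp [headSet]) (by simp) ?_
    · rintro p ⟨-, hp, -, a, -, ha, -⟩
      exact hp a (List.mem_of_mem_head? ha)
    · intro X hr hX
      rw [Set.sdiff_empty]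
      exact (Nat.le_succ k).trans (hU X hr hX)
  intro W
  induction W using WellFoundedLT.induction with
  | ind W ih =>
  intro hWU B hB hhead htail hcut
  rcases W.eq_empty_or_nonempty with rfl | hW
  · exact ⟨B, hB, by simpa using hhead, hcut⟩
  obtain ⟨e, -, htW, hhW, hecut⟩ := exists_edge_of_cut_le hWU hW hcut
    (fun X hXW hX => by
      refine (hU X (fun h => hrU (hWU (hXW h))) ?_).trans (Set.ncard_le_ncard ?_ (Set.toFinite _))
      · rwa [Set.inter_eq_left.2 (hXW.trans hWU)]
      · rintro f ⟨-, hf⟩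
        refine ⟨⟨trivial, fun hfB => ?_⟩, hf⟩
        have : head f ∈ headSet head B := ⟨f, hfB, rfl⟩
        rw [hhead] at this
        exact this.2 (hXW hf.2))
  refine ih (W \ {head e}) (Set.sdiff_singleton_ssubset.2 hhW) (Set.sdiff_subset.trans hWU)
    (insert e B) (hB.insert ?_ ?_) ?_ ?_ ?_
  · rw [hhead]
    exact fun h => h.2 hhW
  · rintro f (rfl | hf) hfe
    · exact htW (hfe ▸ hhW)
    · exact htail f hf (hfe ▸ hhW)
  · rw [headSet_insert, hhead]
    ext x
    by_cases hx : x = head e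
    · simp [hx, hWU hhW]
    · simp [hx]
  · rintro f (rfl | hf) hfW
    · exact htW hfW.1
    · exact htail f hf hfW.1
  · have hset : Set.univ \ insert e B = (Set.univ \ B) \ {e} := by
      ext f
      simp only [Set.mem_sdiff, Set.mem_univ, Set.mem_insert_iff, Set.mem_singleton_iff]
      tauto
    rwa [hset]

end Branching

end RootedDigraph

/-- with `m = max_{v ∈ V} λ_D(r,v) ≥ 1` and
`V_m = {v ∈ V : λ_D(r,v) = m}`, there is a branching `B` in `D` whose head-set
is `V_m` such that `λ_{D−B}(r,v) = λ_D(r,v)` for every `v ∈ V \ V_m` and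
`λ_{D−B}(r,v) ≥ m − 1` for every `v ∈ V_m`. -/
theorem exists_good_branching
    {α E : Type*} [Fintype α] [Fintype E] (tail head : E → α) (r : α)
    (m : ℕ) (hm : 1 ≤ m)
    (hub : ∀ v, v ≠ r → lam tail head Set.univ r v ≤ m)
    (hex : ∃ v, v ≠ r ∧ lam tail head Set.univ r v = m) :
    ∃ B : Set E, IsBranching tail head B ∧
      headSet head B = {v | v ≠ r ∧ lam tail head Set.univ r v = m} ∧
      (∀ v, v ≠ r → lam tail head Set.univ r v ≠ m →
        lam tail head (Set.univ \ B) r v = lam tail head Set.univ r v) ∧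
      (∀ v, v ≠ r → lam tail head Set.univ r v = m →
        m - 1 ≤ lam tail head (Set.univ \ B) r v) := by
  set U : Set α := {v | v ≠ r ∧ lam tail head Set.univ r v = m} with hUdef
  obtain ⟨B, hB, hhead, hcut⟩ := exists_isBranching_of_cut_le (tail := tail) (head := head)
    (r := r) (U := U) (k := m - 1) (fun h => h.1 rfl) (fun X hr ⟨v, hvX, hvr, hv⟩ => by
      rw [Nat.sub_add_cancel hm]
      exact (le_lam_iff hvr).1 hv.ge X hvX hr)
  refine ⟨B, hB, hhead, fun v hvr hv => ?_, fun v hvr hv => ?_⟩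
  · refine le_antisymm (lam_mono_s14 hvr (Set.subset_univ _)) ((le_lam_iff hvr).2 fun X hvX hrX => ?_)
    by_cases hX : (X ∩ U).Nonempty
    · have h1 := hcut X hrX hX
      have h2 := hub v hvr
      omega
    · refine ((le_lam_iff hvr).1 le_rfl X hvX hrX).trans
        (Set.ncard_le_ncard ?_ (Set.toFinite _))
      rintro e ⟨-, he⟩
      exact ⟨⟨trivial, fun heB => hX ⟨head e, he.2, hhead ▸ ⟨e, heB, rfl⟩⟩⟩, he⟩
  · exact (le_lam_iff hvr).2 fun X hvX hrX => hcut X hrX ⟨v, hvX, hvr, hv⟩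
end
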